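/- arXiv:1603.03415 — 3 statements merged into one kernel-verified Lean document; each statement's English description precedes it below -/
import Mathlib

section
/- Let μ be a uniformly distributed measure on ℝ^d with dim₀ μ = n and dim_∞ μ = p, and let K ⊂ ℝ^d be compact. For every ε > 0 there exists τ > 0, depending only on ε, K, μ, n and d, such that every ball B centered at a point of Σ and contained in K contains another ball B′ centered at a point of Σ with radius r(B′) ≥ τ·r(B) and β^n_μ(B′) ≤ ε. -/
open MeasureTheory Metric Filter Set

noncomputable section

abbrev Euc (d : ℕ) : Type := EuclideanSpace ℝ (Fin d)

/-- The support of a measure: points all of whose closed balls have positive measure. -/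
def msupport {d : ℕ} (μ : Measure (Euc d)) : Set (Euc d) :=
  {x | ∀ r : ℝ, 0 < r → 0 < μ (Metric.closedBall x r)}

/-- `φ` is a distribution function of the uniformly distributed measure `μ`. -/
def IsDistributionFunction {d : ℕ} (μ : Measure (Euc d)) (φ : ℝ → ENNReal) : Prop :=
  (msupport μ).Nonempty ∧
  (∀ r : ℝ, 0 < r → 0 < φ r ∧ φ r < ⊤) ∧
  (∀ x ∈ msupport μ, ∀ r : ℝ, 0 < r → μ (Metric.closedBall x r) = φ r)

/-- `μ` is uniformly distributed. -/
def UniformlyDistributed {d : ℕ} (μ : Measure (Euc d)) : Prop :=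
  ∃ φ : ℝ → ENNReal, IsDistributionFunction μ φ

/-- `dim₀ μ = n` : the limit of `φ(r)/rⁿ` as `r → 0⁺` exists, is finite and positive. -/
def HasDim0 (φ : ℝ → ENNReal) (n : ℕ) : Prop :=
  ∃ c : ℝ, 0 < c ∧
    Filter.Tendsto (fun r : ℝ => (φ r).toReal / r ^ n) (nhdsWithin 0 (Set.Ioi 0)) (nhds c)

/-- `dim_∞ μ = p` : the limit of `φ(r)/r^p` as `r → ∞` exists, is finite and positive. -/
def HasDimInfty (φ : ℝ → ENNReal) (p : ℕ) : Prop :=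
  ∃ c : ℝ, 0 < c ∧
    Filter.Tendsto (fun r : ℝ => (φ r).toReal / r ^ p) Filter.atTop (nhds c)

/-- The affine `n`-planes of `ℝ^d`. -/
def nPlanes (d n : ℕ) : Set (AffineSubspace ℝ (Euc d)) :=
  {L | (L : Set (Euc d)).Nonempty ∧ Module.finrank ℝ L.direction = n}

/-- Jones' beta number `β^n_μ(B(x,r))`. -/
def jonesBeta {d : ℕ} (n : ℕ) (μ : Measure (Euc d)) (x : Euc d) (r : ℝ) : ℝ :=
  ⨅ L : nPlanes d n,
    ⨆ y : (msupport μ ∩ Metric.closedBall x r : Set (Euc d)),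
      Metric.infDist y.1 (L.1 : Set (Euc d)) / r

/-- The bilateral beta number `bβ^n_μ(B(x,r))`. -/
def bilateralBeta {d : ℕ} (n : ℕ) (μ : Measure (Euc d)) (x : Euc d) (r : ℝ) : ℝ :=
  ⨅ L : nPlanes d n,
    ((⨆ y : (msupport μ ∩ Metric.closedBall x r : Set (Euc d)),
        Metric.infDist y.1 (L.1 : Set (Euc d)) / r) +
     (⨆ p : ((L.1 : Set (Euc d)) ∩ Metric.closedBall x r : Set (Euc d)),
        Metric.infDist p.1 (msupport μ) / r))

/-- `μ` is doubling with constant `C`. -/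
def DoublingWith {d : ℕ} (μ : Measure (Euc d)) (C : ℝ) : Prop :=
  ∀ x ∈ msupport μ, ∀ r : ℝ, 0 < r →
    μ (Metric.closedBall x (2 * r)) ≤ ENNReal.ofReal C * μ (Metric.closedBall x r)

/-- `μ` is doubling. -/
def Doubling {d : ℕ} (μ : Measure (Euc d)) : Prop :=
  ∃ C : ℝ, 0 < C ∧ DoublingWith μ C

/-- Weak convergence of a sequence of Radon measures. -/
def WeakConv {d : ℕ} (μs : ℕ → Measure (Euc d)) (μ : Measure (Euc d)) : Prop :=
  ∀ f : Euc d → ℝ, Continuous f → HasCompactSupport f →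
    Filter.Tendsto (fun j => ∫ x, f x ∂(μs j)) Filter.atTop (nhds (∫ x, f x ∂μ))

/-- `μ` is `n`-asymptotically optimally doubling. -/
def AsympOptDoubling {d : ℕ} (n : ℕ) (μ : Measure (Euc d)) : Prop :=
  ∀ K : Set (Euc d), IsCompact K → K ⊆ msupport μ →
    ∀ t : ℝ, t ∈ Set.Icc (1/2 : ℝ) 1 →
      Filter.Tendsto
        (fun r : ℝ => ⨆ x : K,
          |(μ (Metric.closedBall x.1 (t * r)) / μ (Metric.closedBall x.1 r)).toReal - t ^ n|)
        (nhdsWithin 0 (Set.Ioi 0)) (nhds 0)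

/-- Truncated `n`-Riesz transform `R_{r,s}μ(z)`. -/
def rieszT {d : ℕ} (n : ℕ) (μ : Measure (Euc d)) (z : Euc d) (r s : ℝ) : Euc d :=
  ∫ y in {y : Euc d | r ≤ dist y z ∧ dist y z ≤ s}, (‖y - z‖ ^ (n + 1))⁻¹ • (y - z) ∂μ

/-- `μ` is locally Ahlfors `n`-regular. -/
def LocallyAhlforsRegular {d : ℕ} (n : ℕ) (μ : Measure (Euc d)) : Prop :=
  ∀ K : Set (Euc d), IsCompact K → ∃ c : ℝ, 0 < c ∧ ∃ rK : ℝ, 0 < rK ∧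
    ∀ x ∈ msupport μ ∩ K, ∀ r : ℝ, 0 < r → r ≤ rK →
      ENNReal.ofReal (c⁻¹ * r ^ n) ≤ μ (Metric.closedBall x r) ∧
      μ (Metric.closedBall x r) ≤ ENNReal.ofReal (c * r ^ n)

/-- `μ` is locally uniformly `n`-rectifiable. -/
def LocUnifRectifiable {d : ℕ} (n : ℕ) (μ : Measure (Euc d)) : Prop :=
  LocallyAhlforsRegular n μ ∧
  ∀ K : Set (Euc d), IsCompact K →
    ∃ RK θK MK : ℝ, 0 < RK ∧ 0 < θK ∧ 0 < MK ∧
      ∀ x ∈ msupport μ ∩ K, ∀ R : ℝ, 0 < R → R ≤ RK →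
        ∃ g : EuclideanSpace ℝ (Fin n) → Euc d,
          LipschitzWith (Real.toNNReal MK) g ∧
          ENNReal.ofReal (θK * R ^ n) ≤ μ (Metric.closedBall x R ∩ Set.range g)

open scoped CompactlySupported Topology

lemma exists_bump {d : ℕ} (z : Euc d) (r : ℝ) {δ : ℝ} (hδ : 0 < δ) :
    ∃ f : C_c(Euc d, ℝ), (∀ x, 0 ≤ f x ∧ f x ≤ 1) ∧ (∀ x ∈ closedBall z r, f x = 1) ∧
      ∀ x ∉ closedBall z (r + δ), f x = 0 := by
  have h0 : ∀ x ∉ closedBall z (r + δ), max 0 (min 1 ((r + δ - dist x z) / δ)) = 0 := by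
    intro x hx
    rw [mem_closedBall, not_le] at hx
    apply max_eq_left
    apply (min_le_right _ _).trans
    apply div_nonpos_of_nonpos_of_nonneg _ hδ.le
    linarith
  refine ⟨⟨⟨fun x => max 0 (min 1 ((r + δ - dist x z) / δ)), by fun_prop⟩,
    HasCompactSupport.intro (isCompact_closedBall z (r + δ)) h0⟩, fun x => ⟨?_, ?_⟩, ?_, h0⟩
  · exact le_max_left _ _
  · exact max_le zero_le_one (min_le_left _ _)
  · intro x hx
    rw [mem_closedBall] at hx
    have h1 : 1 ≤ (r + δ - dist x z) / δ := by
      rw [le_div_iff₀ hδ]; linarith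
    change max 0 (min 1 ((r + δ - dist x z) / δ)) = 1
    rw [min_eq_left h1, max_eq_right zero_le_one]

lemma integrable_compactlySupported {d : ℕ} (μ : Measure (Euc d)) [IsLocallyFiniteMeasure μ]
    (f : C_c(Euc d, ℝ)) : Integrable f μ :=
  f.continuous.integrable_of_hasCompactSupport f.hasCompactSupport

lemma integral_le_measureReal {d : ℕ} (μ : Measure (Euc d)) [IsLocallyFiniteMeasure μ]
    {f : C_c(Euc d, ℝ)} {z : Euc d} {r : ℝ} (h1 : ∀ x, f x ≤ 1)
    (h0 : ∀ x ∉ closedBall z r, f x = 0) : ∫ x, f x ∂μ ≤ μ.real (closedBall z r) := by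
  have hm : MeasurableSet (closedBall z r) := measurableSet_closedBall
  rw [← integral_indicator_one hm]
  refine integral_mono (integrable_compactlySupported μ f) ?_ ?_
  · exact IntegrableOn.integrable_indicator
      (continuousOn_const.integrableOn_compact (isCompact_closedBall z r)) hm
  · intro x
    by_cases hx : x ∈ closedBall z r
    · simpa [hx] using h1 x
    · simp [hx, h0 x hx]

lemma measureReal_le_integral {d : ℕ} (μ : Measure (Euc d)) [IsLocallyFiniteMeasure μ]
    {f : C_c(Euc d, ℝ)} {z : Euc d} {r : ℝ} (h0 : ∀ x, 0 ≤ f x)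
    (h1 : ∀ x ∈ closedBall z r, f x = 1) : μ.real (closedBall z r) ≤ ∫ x, f x ∂μ := by
  have hm : MeasurableSet (closedBall z r) := measurableSet_closedBall
  rw [← integral_indicator_one hm]
  refine integral_mono ?_ (integrable_compactlySupported μ f) ?_
  · exact IntegrableOn.integrable_indicator
      (continuousOn_const.integrableOn_compact (isCompact_closedBall z r)) hm
  · intro x
    by_cases hx : x ∈ closedBall z r
    · simp [hx, h1 x hx]
    · simpa [hx] using h0 x

lemma measure_closedBall_lt_top' {d : ℕ} (μ : Measure (Euc d)) [IsLocallyFiniteMeasure μ]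
    (z : Euc d) (r : ℝ) : μ (closedBall z r) < ⊤ :=
  (isCompact_closedBall z r).measure_lt_top

lemma closedBall_le_of_vague {d : ℕ} {ω : Filter ℕ} [ω.NeBot] {M : ℕ → Measure (Euc d)}
    [∀ j, IsLocallyFiniteMeasure (M j)] {ν : Measure (Euc d)} [IsLocallyFiniteMeasure ν]
    (h : ∀ f : C_c(Euc d, ℝ), Tendsto (fun j => ∫ x, f x ∂M j) ω (𝓝 (∫ x, f x ∂ν)))
    (z : Euc d) (r : ℝ) {δ : ℝ} (hδ : 0 < δ) {t : ℝ} (ht : 0 ≤ t)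
    (hM : ∀ᶠ j in ω, M j (closedBall z (r + δ)) ≤ ENNReal.ofReal t) :
    ν (closedBall z r) ≤ ENNReal.ofReal t := by
  obtain ⟨f, hf, hf1, hf0⟩ := exists_bump z r hδ
  rw [ENNReal.le_ofReal_iff_toReal_le (measure_closedBall_lt_top' ν z r).ne ht]
  refine (measureReal_le_integral ν (fun x => (hf x).1) hf1).trans (le_of_tendsto (h f) ?_)
  filter_upwards [hM] with j hj
  refine (integral_le_measureReal (M j) (fun x => (hf x).2) hf0).trans ?_
  exact (ENNReal.le_ofReal_iff_toReal_le (measure_closedBall_lt_top' _ _ _).ne ht).1 hj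

lemma le_closedBall_of_vague {d : ℕ} {ω : Filter ℕ} [ω.NeBot] {M : ℕ → Measure (Euc d)}
    [∀ j, IsLocallyFiniteMeasure (M j)] {ν : Measure (Euc d)} [IsLocallyFiniteMeasure ν]
    (h : ∀ f : C_c(Euc d, ℝ), Tendsto (fun j => ∫ x, f x ∂M j) ω (𝓝 (∫ x, f x ∂ν)))
    (z : Euc d) (r : ℝ) {δ : ℝ} (hδ : 0 < δ) {t : ℝ}
    (hM : ∀ᶠ j in ω, ENNReal.ofReal t ≤ M j (closedBall z r)) :
    ENNReal.ofReal t ≤ ν (closedBall z (r + δ)) := by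
  obtain ⟨f, hf, hf1, hf0⟩ := exists_bump z r hδ
  rw [ENNReal.ofReal_le_iff_le_toReal (measure_closedBall_lt_top' ν z _).ne]
  refine le_trans (ge_of_tendsto (h f) ?_) (integral_le_measureReal ν (fun x => (hf x).2) hf0)
  filter_upwards [hM] with j hj
  refine le_trans ?_ (measureReal_le_integral (M j) (fun x => (hf x).1) hf1)
  exact (ENNReal.ofReal_le_iff_le_toReal (measure_closedBall_lt_top' _ _ _).ne).1 hj

/-- Vague compactness along an ultrafilter of a sequence of measures with locally bounded mass. -/
lemma exists_vague_limit {d : ℕ} (ω : Ultrafilter ℕ) (M : ℕ → Measure (Euc d))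
    [∀ j, IsLocallyFiniteMeasure (M j)]
    (hM : ∀ R : ℝ, 0 < R → ∃ C : ℝ, ∀ᶠ j in ω, (M j).real (closedBall 0 R) ≤ C) :
    ∃ ν : Measure (Euc d), IsLocallyFiniteMeasure ν ∧
      ∀ f : C_c(Euc d, ℝ), Tendsto (fun j => ∫ x, f x ∂M j) ω (𝓝 (∫ x, f x ∂ν)) := by
  have L (g : C_c(Euc d, ℝ)) : ∃ a : ℝ, Tendsto (fun j => ∫ x, g x ∂M j) ω (𝓝 a) := by
    obtain ⟨R, hR, hgR⟩ : ∃ R : ℝ, 0 < R ∧ ∀ x ∉ closedBall (0 : Euc d) R, g x = 0 := by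
      obtain ⟨R, hR, hgR⟩ := g.hasCompactSupport.isCompact.isBounded.subset_closedBall_lt 0 0
      exact ⟨R, hR, fun x hx => image_eq_zero_of_notMem_tsupport fun h => hx (hgR h)⟩
    obtain ⟨C, hC⟩ := hM R hR
    obtain ⟨B, hB⟩ : ∃ B : ℝ, ∀ x, ‖g x‖ ≤ B :=
      g.continuous.bounded_above_of_compact_support g.hasCompactSupport
    have hB0 : 0 ≤ B := (norm_nonneg _).trans (hB 0)
    obtain ⟨a, -, ha⟩ := IsCompact.ultrafilter_le_nhds' (isCompact_Icc (a := -(B * C)) (b := B * C))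
      (ω.map fun j => ∫ x, g x ∂M j) (by
        rw [Ultrafilter.mem_map]
        filter_upwards [hC] with j hj
        rw [mem_preimage, mem_Icc, ← abs_le]
        have hset : ∫ x, g x ∂M j = ∫ x in closedBall 0 R, g x ∂M j :=
          (setIntegral_eq_integral_of_forall_compl_eq_zero fun x hx => hgR x hx).symm
        rw [hset, ← Real.norm_eq_abs]
        refine (norm_setIntegral_le_of_norm_le_const (measure_closedBall_lt_top' _ _ _)
          fun x _ => hB x).trans ?_
        gcongr)
    exact ⟨a, ha⟩
  choose Λ hΛ using L
  let Λ' : C_c(Euc d, ℝ) →ₚ[ℝ] ℝ :=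
  { toFun := Λ
    map_add' g g' := by
      have : Tendsto (fun j => ∫ x, g x + g' x ∂M j) ω (𝓝 (Λ g + Λ g')) := by
        convert! (hΛ g).add (hΛ g') using 2 with j
        exact integral_add (integrable_compactlySupported _ g) (integrable_compactlySupported _ g')
      exact tendsto_nhds_unique (hΛ (g + g')) this
    map_smul' c g := by
      have : Tendsto (fun j => ∫ x, c • g x ∂M j) ω (𝓝 (c • Λ g)) := by
        convert! (hΛ g).const_smul c using 2 with j
        exact integral_smul _ _
      exact tendsto_nhds_unique (hΛ (c • g)) this
    monotone' g g' hgg' := by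
      apply le_of_tendsto_of_tendsto' (hΛ g) (hΛ g') (fun j ↦ ?_)
      exact integral_mono (integrable_compactlySupported _ g) (integrable_compactlySupported _ g')
        hgg' }
  refine ⟨RealRMK.rieszMeasure Λ', inferInstance, fun f => ?_⟩
  rw [RealRMK.integral_rieszMeasure]
  exact hΛ f

lemma msupport_eq_support {d : ℕ} (μ : Measure (Euc d)) : msupport μ = μ.support := by
  ext x
  rw [nhds_basis_closedBall.mem_measureSupport]
  rfl

lemma isClosed_msupport {d : ℕ} (μ : Measure (Euc d)) : IsClosed (msupport μ) := by
  rw [msupport_eq_support]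
  exact Measure.isClosed_support

lemma ae_mem_msupport {d : ℕ} (μ : Measure (Euc d)) : ∀ᵐ x ∂μ, x ∈ msupport μ := by
  rw [msupport_eq_support]
  exact Measure.support_mem_ae

lemma exists_mem_msupport_of_pos {d : ℕ} {μ : Measure (Euc d)} {z : Euc d} {r : ℝ}
    (h : 0 < μ (closedBall z r)) : ∃ x ∈ msupport μ, dist x z ≤ r := by
  obtain ⟨x, hx, hx'⟩ := Measure.nonempty_inter_support_of_pos h
  exact ⟨x, by rwa [msupport_eq_support], hx⟩

/-- Limits of measures whose common ball functions converge to `r ^ n` are `n`-uniform, and their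
support is the set of limits of points of the supports. -/
lemma exists_uniform_limit {d n : ℕ} (ω : Ultrafilter ℕ) (M : ℕ → Measure (Euc d))
    [∀ j, IsLocallyFiniteMeasure (M j)] (ψ : ℕ → ℝ → ℝ)
    (hψ : ∀ j, ∀ x ∈ msupport (M j), ∀ r : ℝ, 0 < r →
      M j (closedBall x r) = ENNReal.ofReal (ψ j r))
    (hlim : ∀ r : ℝ, 0 < r → Tendsto (fun j => ψ j r) ω (𝓝 (r ^ n)))
    (h0 : ∀ j, 0 ∈ msupport (M j)) :
    ∃ ν : Measure (Euc d), IsLocallyFiniteMeasure ν ∧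
      (∀ x ∈ msupport ν, ∀ r : ℝ, 0 < r → ν (closedBall x r) = ENNReal.ofReal (r ^ n)) ∧
      ∀ z, z ∈ msupport ν ↔ ∃ u : ℕ → Euc d, (∀ j, u j ∈ msupport (M j)) ∧
        Tendsto u ω (𝓝 z) := by
  have hle : ∀ r : ℝ, 0 < r → ∀ δ : ℝ, 0 < δ → ∀ᶠ j in (ω : Filter ℕ), ψ j r ≤ r ^ n + δ :=
    fun r hr δ hδ => (hlim r hr).eventually_le_const (by linarith)
  have hge : ∀ r : ℝ, 0 < r → ∀ δ : ℝ, 0 < δ → ∀ᶠ j in (ω : Filter ℕ), r ^ n - δ ≤ ψ j r :=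
    fun r hr δ hδ => (hlim r hr).eventually_const_le (by linarith)
  obtain ⟨ν, hν, hconv⟩ := exists_vague_limit ω M (by
    intro R hR
    refine ⟨R ^ n + 1, ?_⟩
    filter_upwards [hle R hR 1 one_pos] with j hj
    refine ENNReal.toReal_le_of_le_ofReal (by positivity) ?_
    rw [hψ j 0 (h0 j) R hR]
    exact ENNReal.ofReal_le_ofReal hj)
  have hU : ∀ (z : Euc d) (u : ℕ → Euc d), (∀ j, u j ∈ msupport (M j)) → Tendsto u ω (𝓝 z) →
      ∀ r : ℝ, 0 < r → ν (closedBall z r) ≤ ENNReal.ofReal (r ^ n) := by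
    intro z u hu huz r hr
    have key : ∀ δ : ℝ, 0 < δ → ν (closedBall z r) ≤ ENNReal.ofReal ((r + 2 * δ) ^ n + δ) := by
      intro δ hδ
      refine closedBall_le_of_vague hconv z r hδ (by positivity) ?_
      filter_upwards [hle (r + 2 * δ) (by positivity) δ hδ,
        huz.eventually (closedBall_mem_nhds z hδ)] with j hj hj'
      refine le_trans (measure_mono ?_)
        ((hψ j (u j) (hu j) (r + 2 * δ) (by positivity)).le.trans (ENNReal.ofReal_le_ofReal hj))
      apply closedBall_subset_closedBall'
      rw [dist_comm] at hj'
      linarith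
    have ht : Tendsto (fun δ : ℝ => ENNReal.ofReal ((r + 2 * δ) ^ n + δ)) (𝓝[>] 0)
        (𝓝 (ENNReal.ofReal (r ^ n))) := by
      refine ENNReal.tendsto_ofReal (Tendsto.mono_left ?_ nhdsWithin_le_nhds)
      have : Continuous fun δ : ℝ => (r + 2 * δ) ^ n + δ := by fun_prop
      simpa using this.tendsto 0
    exact ge_of_tendsto ht (eventually_mem_nhdsWithin.mono key)
  have hL : ∀ (z : Euc d) (u : ℕ → Euc d), (∀ j, u j ∈ msupport (M j)) → Tendsto u ω (𝓝 z) →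
      ∀ r : ℝ, 0 < r → ENNReal.ofReal (r ^ n) ≤ ν (closedBall z r) := by
    intro z u hu huz r hr
    have key : ∀ δ : ℝ, δ ∈ Ioo 0 (r / 2) →
        ENNReal.ofReal ((r - 2 * δ) ^ n - δ) ≤ ν (closedBall z r) := by
      intro δ hδ
      have hδ1 := hδ.1
      have hδ2 := hδ.2
      have := le_closedBall_of_vague hconv z (r - δ) hδ1 (t := (r - 2 * δ) ^ n - δ) (by
        filter_upwards [hge (r - 2 * δ) (by linarith) δ hδ1,
          huz.eventually (closedBall_mem_nhds z hδ1)] with j hj hj'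
        refine le_trans ((ENNReal.ofReal_le_ofReal hj).trans
          (hψ j (u j) (hu j) (r - 2 * δ) (by linarith)).ge) (measure_mono ?_)
        apply closedBall_subset_closedBall'
        linarith)
      simpa using this
    have ht : Tendsto (fun δ : ℝ => ENNReal.ofReal ((r - 2 * δ) ^ n - δ)) (𝓝[>] 0)
        (𝓝 (ENNReal.ofReal (r ^ n))) := by
      refine ENNReal.tendsto_ofReal (Tendsto.mono_left ?_ nhdsWithin_le_nhds)
      have : Continuous fun δ : ℝ => (r - 2 * δ) ^ n - δ := by fun_prop
      simpa using this.tendsto 0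
    refine le_of_tendsto ht ?_
    filter_upwards [Ioo_mem_nhdsGT (half_pos hr)] with δ hδ using key δ hδ
  have hsupp : ∀ z, z ∈ msupport ν ↔ ∃ u : ℕ → Euc d, (∀ j, u j ∈ msupport (M j)) ∧
      Tendsto u ω (𝓝 z) := by
    refine fun z => ⟨fun hz => ?_, fun ⟨u, hu, huz⟩ r hr => ?_⟩
    · choose u hu hud using fun j =>
        (isClosed_msupport (M j)).exists_infDist_eq_dist ⟨0, h0 j⟩ z
      refine ⟨u, hu, Metric.tendsto_nhds.2 fun δ hδ => ?_⟩
      by_contra hcon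
      rw [← Ultrafilter.eventually_not] at hcon
      have hzero : ν (closedBall z (δ / 4)) ≤ ENNReal.ofReal 0 := by
        refine closedBall_le_of_vague hconv z (δ / 4) (δ := δ / 4) (by positivity) le_rfl ?_
        filter_upwards [hcon] with j hj
        rw [ENNReal.ofReal_zero, nonpos_iff_eq_zero]
        by_contra hne
        obtain ⟨x, hx, hxz⟩ := exists_mem_msupport_of_pos (pos_iff_ne_zero.2 hne)
        apply hj
        rw [dist_comm, ← hud j]
        have := infDist_le_dist_of_mem (x := z) hx
        rw [dist_comm] at this
        linarith
      have := hz (δ / 4) (by positivity)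
      simp only [ENNReal.ofReal_zero, nonpos_iff_eq_zero] at hzero
      exact this.ne' hzero
    · exact lt_of_lt_of_le (ENNReal.ofReal_pos.2 (by positivity)) (hL z u hu huz r hr)
  refine ⟨ν, hν, fun x hx r hr => ?_, hsupp⟩
  obtain ⟨u, hu, hux⟩ := (hsupp x).1 hx
  exact le_antisymm (hU x u hu hux r hr) (hL x u hu hux r hr)

/-- Blow-ups of a uniformly distributed measure of lower dimension `n` at scales tending to `0`
have an `n`-uniform limit. -/
lemma exists_blowup {d n : ℕ} (ω : Ultrafilter ℕ) (μ : Measure (Euc d)) [IsLocallyFiniteMeasure μ]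
    {φ : ℝ → ENNReal} (hφ : IsDistributionFunction μ φ) (hn : HasDim0 φ n)
    {x : ℕ → Euc d} (hx : ∀ j, x j ∈ msupport μ) {s : ℕ → ℝ} (hs : ∀ j, 0 < s j)
    (hs0 : Tendsto s ω (𝓝 0)) :
    ∃ ν : Measure (Euc d), IsLocallyFiniteMeasure ν ∧
      (∀ x ∈ msupport ν, ∀ r : ℝ, 0 < r → ν (closedBall x r) = ENNReal.ofReal (r ^ n)) ∧
      ∀ z, z ∈ msupport ν ↔ ∃ u : ℕ → Euc d, (∀ j, x j + s j • u j ∈ msupport μ) ∧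
        Tendsto u ω (𝓝 z) := by
  obtain ⟨c, hc, hlim⟩ := hn
  obtain ⟨-, hfin, hball⟩ := hφ
  set a : ℕ → ℝ := fun j => (c * s j ^ n)⁻¹ with ha
  have ha0 : ∀ j, 0 < a j := fun j => by
    have := hs j
    positivity
  set g : ℕ → Euc d → Euc d := fun j z => (s j)⁻¹ • (z - x j) with hg
  have hgm : ∀ j, Measurable (g j) := fun j => by
    have : Continuous (g j) := by fun_prop
    exact this.measurable
  set M : ℕ → Measure (Euc d) := fun j => ENNReal.ofReal (a j) • μ.map (g j) with hM
  have hpre : ∀ j y r, g j ⁻¹' closedBall y r = closedBall (x j + s j • y) (s j * r) := by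
    intro j y r
    ext z
    have hsj := hs j
    have : s j • (g j z - y) = z - (x j + s j • y) := by
      rw [smul_sub, hg]
      simp only
      rw [smul_inv_smul₀ hsj.ne']
      abel
    rw [mem_preimage, mem_closedBall, mem_closedBall, dist_eq_norm, dist_eq_norm, ← this, norm_smul,
      Real.norm_of_nonneg hsj.le, mul_le_mul_iff_right₀ hsj]
  have hMb : ∀ j y r, M j (closedBall y r) =
      ENNReal.ofReal (a j) * μ (closedBall (x j + s j • y) (s j * r)) := by
    intro j y r
    rw [hM, Measure.smul_apply, Measure.map_apply (hgm j) measurableSet_closedBall, hpre,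
      smul_eq_mul]
  have hMs : ∀ j y, y ∈ msupport (M j) ↔ x j + s j • y ∈ msupport μ := by
    intro j y
    have hsj := hs j
    refine ⟨fun h r hr => ?_, fun h r hr => ?_⟩
    · have := h (r / s j) (by positivity)
      rw [hMb, mul_div_cancel₀ _ hsj.ne'] at this
      exact (ENNReal.mul_pos_iff.1 this).2
    · rw [hMb]
      exact ENNReal.mul_pos (ENNReal.ofReal_pos.2 (ha0 j)).ne' (h _ (by positivity)).ne'
  have hMl : ∀ j, IsLocallyFiniteMeasure (M j) := by
    refine fun j => ⟨fun y => ⟨closedBall y 1, closedBall_mem_nhds y one_pos, ?_⟩⟩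
    rw [hMb]
    exact ENNReal.mul_lt_top ENNReal.ofReal_lt_top (measure_closedBall_lt_top' _ _ _)
  obtain ⟨ν, h1, h2, h3⟩ := exists_uniform_limit (n := n) ω M
    (fun j r => a j * (φ (s j * r)).toReal) (by
      intro j y hy r hr
      have hsr : 0 < s j * r := mul_pos (hs j) hr
      rw [hMb, hball _ ((hMs j y).1 hy) _ hsr, ENNReal.ofReal_mul (ha0 j).le,
        ENNReal.ofReal_toReal (hfin _ hsr).2.ne]) (by
      intro r hr
      have ht : Tendsto (fun j => s j * r) ω (𝓝[>] 0) := by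
        refine tendsto_nhdsWithin_iff.2 ⟨?_, Eventually.of_forall fun j => mul_pos (hs j) hr⟩
        simpa using hs0.mul_const r
      have h := ((hlim.comp ht).const_mul c⁻¹).mul_const (r ^ n)
      rw [inv_mul_cancel₀ hc.ne', one_mul] at h
      refine h.congr fun j => ?_
      have := hs j
      simp only [ha, Function.comp]
      field_simp
      ring) (by
      intro j
      rw [hMs, smul_zero, add_zero]
      exact hx j)
  refine ⟨ν, h1, h2, fun z => ?_⟩
  simp only [h3, hMs]

/-- Fubini comparison of two measures carried by `V` and having constant ball measure on `V`. -/
lemma measure_closedBall_mul_le {d : ℕ} (α β : Measure (Euc d)) [SFinite α] [SFinite β]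
    {V : Set (Euc d)} (hα : ∀ᵐ x ∂α, x ∈ V) (hβ : ∀ᵐ x ∂β, x ∈ V) {r : ℝ} {A B : ENNReal}
    (hA : ∀ x ∈ V, α (closedBall x r) = A) (hB : ∀ x ∈ V, β (closedBall x r) = B) (x₀ : Euc d) :
    α (closedBall x₀ 1) * B ≤ A * β (closedBall x₀ (1 + r)) := by
  set s : Set (Euc d × Euc d) := {p | dist p.1 x₀ ≤ 1 ∧ dist p.1 p.2 ≤ r} with hs
  have hsm : MeasurableSet s := by
    apply IsClosed.measurableSet
    have h1 : Continuous fun p : Euc d × Euc d => dist p.1 x₀ := by fun_prop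
    have h2 : Continuous fun p : Euc d × Euc d => dist p.1 p.2 := by fun_prop
    exact (isClosed_le h1 continuous_const).inter (isClosed_le h2 continuous_const)
  calc α (closedBall x₀ 1) * B = ∫⁻ x in closedBall x₀ 1, B ∂α := by
        rw [setLIntegral_const, mul_comm]
    _ = ∫⁻ x in closedBall x₀ 1, β (Prod.mk x ⁻¹' s) ∂α := by
        refine setLIntegral_congr_fun_ae measurableSet_closedBall ?_
        filter_upwards [hα] with x hx hx1
        rw [← hB x hx]
        congr 1
        ext y
        rw [mem_closedBall, dist_comm]
        exact ⟨fun h => ⟨hx1, h⟩, fun h => h.2⟩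
    _ ≤ ∫⁻ x, β (Prod.mk x ⁻¹' s) ∂α := setLIntegral_le_lintegral _ _
    _ = (α.prod β) s := (Measure.prod_apply hsm).symm
    _ = ∫⁻ y, α ((fun x => (x, y)) ⁻¹' s) ∂β := Measure.prod_apply_symm hsm
    _ ≤ ∫⁻ y, (closedBall x₀ (1 + r)).indicator (fun _ => A) y ∂β := by
        refine lintegral_mono_ae ?_
        filter_upwards [hβ] with y hy
        by_cases hy1 : y ∈ closedBall x₀ (1 + r)
        · rw [indicator_of_mem hy1, ← hA y hy]
          exact measure_mono fun x hx => hx.2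
        · rw [indicator_of_notMem hy1, nonpos_iff_eq_zero]
          convert! measure_empty (μ := α)
          refine eq_empty_of_forall_notMem fun x hx => hy1 ?_
          have h1 := hx.1
          have h2 := hx.2
          simp only at h1 h2
          rw [mem_closedBall]
          rw [dist_comm] at h2
          linarith [dist_triangle y x x₀]
    _ = A * β (closedBall x₀ (1 + r)) := by
        rw [lintegral_indicator measurableSet_closedBall, setLIntegral_const]

lemma le_of_forall_pow_le {k n : ℕ} (h : ∀ r : ℝ, 0 < r → r ^ k ≤ (1 + r) ^ k * r ^ n) :
    n ≤ k := by
  by_contra! hlt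
  obtain ⟨m, rfl⟩ : ∃ m, n = k + 1 + m := ⟨n - (k + 1), by omega⟩
  set r : ℝ := 2⁻¹ * (2 ^ k)⁻¹ with hr
  have hr0 : 0 < r := by positivity
  have h1 : r ≤ 1 := by
    have : (2 ^ k : ℝ)⁻¹ ≤ 1 := inv_le_one_of_one_le₀ (one_le_pow₀ (by norm_num))
    rw [hr]; linarith
  have h2 : (1 + r) ^ k ≤ 2 ^ k := pow_le_pow_left₀ (by positivity) (by linarith) k
  have h3 : r ^ m ≤ 1 := pow_le_one₀ hr0.le h1
  have h4 : r ^ k ≤ r ^ k * 2⁻¹ := by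
    calc r ^ k ≤ (1 + r) ^ k * r ^ (k + 1 + m) := h r hr0
      _ = (1 + r) ^ k * (r ^ k * r * r ^ m) := by ring
      _ ≤ 2 ^ k * (r ^ k * r * 1) := by gcongr
      _ = r ^ k * 2⁻¹ := by
        rw [mul_one, hr]
        field_simp
  have : 0 < r ^ k := by positivity
  linarith

/-- An `n`-uniform measure whose support is a linear subspace has support of dimension `n`. -/
lemma finrank_eq_of_msupport_eq {d n : ℕ} (ν : Measure (Euc d)) [IsLocallyFiniteMeasure ν]
    (hν : ∀ x ∈ msupport ν, ∀ r : ℝ, 0 < r → ν (closedBall x r) = ENNReal.ofReal (r ^ n))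
    (V : Submodule ℝ (Euc d)) (hV : msupport ν = V) : Module.finrank ℝ V = n := by
  set k := Module.finrank ℝ V with hk
  set α : Measure (Euc d) := (volume : Measure V).map V.subtypeL with hα
  have hmeas : Measurable V.subtypeL := V.subtypeL.continuous.measurable
  set κ : ENNReal := (volume : Measure V) (ball 0 1) with hκ
  have hκ0 : κ ≠ 0 := (measure_ball_pos _ _ one_pos).ne'
  have hκt : κ ≠ ⊤ := measure_ball_lt_top.ne
  have hαb : ∀ x ∈ V, ∀ r : ℝ, 0 < r →
      α (closedBall x r) = ENNReal.ofReal (r ^ k) * κ := by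
    intro x hx r hr
    rw [hα, Measure.map_apply hmeas measurableSet_closedBall]
    have : V.subtypeL ⁻¹' closedBall x r = closedBall (⟨x, hx⟩ : V) r := by
      ext z
      simp [Subtype.dist_eq]
    rw [this, Measure.addHaar_closedBall _ _ hr.le]
  have hαV : ∀ᵐ x ∂α, x ∈ (V : Set (Euc d)) := by
    refine (ae_map_iff hmeas.aemeasurable V.closed_of_finiteDimensional.measurableSet).2 ?_
    exact Eventually.of_forall fun x => x.2
  have hνV : ∀ᵐ x ∂ν, x ∈ (V : Set (Euc d)) := hV ▸ ae_mem_msupport ν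
  rw [hV] at hν
  have hz : (0 : Euc d) ∈ V := V.zero_mem
  have key : ∀ {X Y Z : ℝ}, 0 ≤ X → 0 ≤ Y → 0 ≤ Z →
      ENNReal.ofReal X * κ ≤ ENNReal.ofReal Y * κ * ENNReal.ofReal Z → X ≤ Z * Y := by
    intro X Y Z hX hY hZ h
    rw [mul_right_comm, ENNReal.mul_le_mul_iff_left hκ0 hκt, ← ENNReal.ofReal_mul hY,
      ENNReal.ofReal_le_ofReal_iff (by positivity), mul_comm] at h
    exact h
  apply le_antisymm
  · refine le_of_forall_pow_le fun r hr => ?_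
    have h := measure_closedBall_mul_le α ν hαV hνV (fun x hx => hαb x hx r hr)
      (fun x hx => hν x hx r hr) 0
    rw [hν 0 hz _ (by positivity), hαb 0 hz _ one_pos, one_pow, ENNReal.ofReal_one, one_mul,
      mul_comm κ] at h
    exact key (by positivity) (by positivity) (by positivity) h
  · refine le_of_forall_pow_le fun r hr => ?_
    have h := measure_closedBall_mul_le ν α hνV hαV (fun x hx => hν x hx r hr)
      (fun x hx => hαb x hx r hr) 0
    rw [hν 0 hz 1 one_pos, hαb 0 hz _ (by positivity), one_pow, ENNReal.ofReal_one, one_mul,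
      ← mul_assoc, mul_right_comm] at h
    exact key (by positivity) (by positivity) (by positivity) h

/-- Integrals of radial cut-offs around points of the support do not depend on the point. -/
lemma lintegral_radial_eq {d : ℕ} (μ : Measure (Euc d)) {φ : ℝ → ENNReal}
    (hball : ∀ x ∈ msupport μ, ∀ r : ℝ, 0 < r → μ (closedBall x r) = φ r)
    (R : ℝ) {x y : Euc d} (hx : x ∈ msupport μ) (hy : y ∈ msupport μ) :
    ∫⁻ z, ENNReal.ofReal ((max (R ^ 2 - ‖z - x‖ ^ 2) 0) ^ 2) ∂μ =
      ∫⁻ z, ENNReal.ofReal ((max (R ^ 2 - ‖z - y‖ ^ 2) 0) ^ 2) ∂μ := by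
  have hset : ∀ t : ℝ, 0 < t → t ≠ R ^ 4 → ∃ A, ∀ x ∈ msupport μ,
      μ {z | t ≤ (max (R ^ 2 - ‖z - x‖ ^ 2) 0) ^ 2} = A := by
    intro t ht htR
    have hst : 0 < √t := Real.sqrt_pos.2 ht
    have hiff : ∀ x z : Euc d, t ≤ (max (R ^ 2 - ‖z - x‖ ^ 2) 0) ^ 2 ↔
        ‖z - x‖ ^ 2 ≤ R ^ 2 - √t := by
      intro x z
      rw [← Real.sqrt_le_left (le_max_right _ _), le_max_iff]
      constructor
      · rintro (h | h) <;> linarith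
      · intro h
        left
        linarith
    rcases lt_or_ge (R ^ 2) (√t) with h | h
    · refine ⟨0, fun x _ => ?_⟩
      convert! measure_empty (μ := μ)
      refine eq_empty_of_forall_notMem fun z hz => ?_
      have := (hiff x z).1 hz
      have := sq_nonneg ‖z - x‖
      linarith
    · have hlt : 0 < R ^ 2 - √t := by
        refine sub_pos.2 (lt_of_le_of_ne h fun h' => htR ?_)
        rw [← Real.sq_sqrt ht.le, h']
        ring
      refine ⟨φ √(R ^ 2 - √t), fun x hx => ?_⟩
      rw [← hball x hx _ (Real.sqrt_pos.2 hlt)]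
      congr 1
      ext z
      rw [mem_ofPred_eq, hiff, mem_closedBall, dist_eq_norm, Real.le_sqrt (norm_nonneg _) hlt.le]
  have hm : ∀ x : Euc d, AEMeasurable (fun z => (max (R ^ 2 - ‖z - x‖ ^ 2) 0) ^ 2) μ := by
    intro x
    have : Continuous fun z : Euc d => (max (R ^ 2 - ‖z - x‖ ^ 2) 0) ^ 2 := by fun_prop
    exact this.measurable.aemeasurable
  rw [lintegral_eq_lintegral_meas_le μ (Eventually.of_forall fun z => sq_nonneg _) (hm x),
    lintegral_eq_lintegral_meas_le μ (Eventually.of_forall fun z => sq_nonneg _) (hm y)]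
  refine setLIntegral_congr_fun_ae measurableSet_Ioi ?_
  have hne : ∀ᵐ t : ℝ, t ≠ R ^ 4 := by simp [ae_iff]
  filter_upwards [hne] with t ht ht0
  obtain ⟨A, hA⟩ := hset t ht0 ht
  rw [hA x hx, hA y hy]

lemma abs_sq_max_sub_le (a h : ℝ) :
    |(max (a + h) 0) ^ 2 - (max a 0) ^ 2 - 2 * max a 0 * h| ≤ h ^ 2 := by
  rw [abs_le]
  rcases le_total a 0 with ha | ha <;> rcases le_total (a + h) 0 with hb | hb <;>
    simp only [max_eq_left, max_eq_right, ha, hb] <;> constructor <;> nlinarith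

/-- Preiss' barycentre estimate: the weighted barycentre of a uniformly distributed measure is
orthogonal to its support up to a quadratic error. -/
lemma exists_barycenter_bound {d : ℕ} (μ : Measure (Euc d)) [IsLocallyFiniteMeasure μ]
    {φ : ℝ → ENNReal}
    (hball : ∀ x ∈ msupport μ, ∀ r : ℝ, 0 < r → μ (closedBall x r) = φ r)
    (h0 : 0 ∈ msupport μ) {R : ℝ} (hR : 0 < R) :
    ∃ C : ℝ, ∀ y ∈ msupport μ, ‖y‖ ≤ 1 →
      |inner ℝ (∫ z, max (R ^ 2 - ‖z‖ ^ 2) 0 • z ∂μ) y| ≤ C * ‖y‖ ^ 2 := by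
  set w : Euc d → ℝ := fun z => max (R ^ 2 - ‖z‖ ^ 2) 0 with hw
  have hwc : Continuous w := by fun_prop
  have hw0 : ∀ z, 0 ≤ w z := fun z => le_max_right _ _
  have hwR : ∀ z ∉ closedBall (0 : Euc d) R, w z = 0 := by
    intro z hz
    rw [mem_closedBall_zero_iff, not_le] at hz
    exact max_eq_right (by nlinarith)
  have hws : HasCompactSupport w := HasCompactSupport.intro (isCompact_closedBall 0 R) hwR
  have hwi : Integrable w μ := hwc.integrable_of_hasCompactSupport hws
  have hwzi : Integrable (fun z => w z • z) μ :=
    (by fun_prop : Continuous fun z => w z • z).integrable_of_hasCompactSupport hws.smul_right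
  set m : ℝ := μ.real (closedBall 0 (R + 1)) with hm
  refine ⟨(2 * ∫ z, w z ∂μ + (2 * (R + 1) + 1) ^ 2 * m) / 4, fun y hy hy1 => ?_⟩
  have hwyR : ∀ z ∉ closedBall (0 : Euc d) (R + 1), w (z - y) = 0 := by
    intro z hz
    refine hwR _ fun h => hz ?_
    rw [mem_closedBall_zero_iff] at h ⊢
    calc ‖z‖ = ‖(z - y) + y‖ := by rw [sub_add_cancel]
      _ ≤ ‖z - y‖ + ‖y‖ := norm_add_le _ _
      _ ≤ R + 1 := by linarith
  have hwyc : Continuous fun z => w (z - y) := by fun_prop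
  have hF : Integrable (fun z => w z ^ 2) μ :=
    (hwc.pow 2).integrable_of_hasCompactSupport
      (HasCompactSupport.intro (isCompact_closedBall 0 R) fun z hz => by simp [hwR z hz])
  have hFy : Integrable (fun z => w (z - y) ^ 2) μ :=
    (hwyc.pow 2).integrable_of_hasCompactSupport
      (HasCompactSupport.intro (isCompact_closedBall 0 (R + 1)) fun z hz => by simp [hwyR z hz])
  have heq : ∫ z, w (z - y) ^ 2 ∂μ = ∫ z, w z ^ 2 ∂μ := by
    rw [integral_eq_lintegral_of_nonneg_ae (Eventually.of_forall fun z => sq_nonneg _)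
        (hwyc.pow 2).aestronglyMeasurable,
      integral_eq_lintegral_of_nonneg_ae (Eventually.of_forall fun z => sq_nonneg _)
        (hwc.pow 2).aestronglyMeasurable]
    have := lintegral_radial_eq μ hball R hy h0
    simp only [sub_zero] at this
    rw [← this]
  set h : Euc d → ℝ := fun z => 2 * inner ℝ z y - ‖y‖ ^ 2 with hh
  have hhc : Continuous h := by fun_prop
  have hwh : Integrable (fun z => w z * h z) μ :=
    (hwc.mul hhc).integrable_of_hasCompactSupport hws.mul_right
  have hpt : ∀ z, ‖w (z - y) ^ 2 - w z ^ 2 - 2 * (w z * h z)‖ ≤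
      (closedBall (0 : Euc d) (R + 1)).indicator
        (fun _ => ((2 * (R + 1) + 1) * ‖y‖) ^ 2) z := by
    intro z
    by_cases hz : z ∈ closedBall (0 : Euc d) (R + 1)
    · rw [indicator_of_mem hz, Real.norm_eq_abs]
      have h1 := abs_sq_max_sub_le (R ^ 2 - ‖z‖ ^ 2) (h z)
      have h2 : R ^ 2 - ‖z‖ ^ 2 + h z = R ^ 2 - ‖z - y‖ ^ 2 := by
        rw [hh, norm_sub_sq_real]
        ring
      rw [h2, mul_assoc] at h1
      refine h1.trans ?_
      rw [mem_closedBall_zero_iff] at hz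
      rw [← sq_abs (h z)]
      refine pow_le_pow_left₀ (abs_nonneg _) ?_ 2
      calc |h z| ≤ |2 * inner ℝ z y| + |‖y‖ ^ 2| := abs_sub _ _
        _ = 2 * |inner ℝ z y| + ‖y‖ ^ 2 := by
          rw [abs_mul, abs_of_pos two_pos, abs_of_nonneg (sq_nonneg ‖y‖)]
        _ ≤ 2 * (‖z‖ * ‖y‖) + ‖y‖ * 1 := by
          gcongr
          · exact abs_real_inner_le_norm z y
          · rw [sq]
            gcongr
        _ ≤ 2 * ((R + 1) * ‖y‖) + ‖y‖ * 1 := by gcongr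
        _ = (2 * (R + 1) + 1) * ‖y‖ := by ring
    · have hz' : z ∉ closedBall (0 : Euc d) R := fun h =>
        hz (closedBall_subset_closedBall (by linarith) h)
      simp [indicator_of_notMem hz, hwR z hz', hwyR z hz]
  have hbound : ‖∫ z, (w (z - y) ^ 2 - w z ^ 2 - 2 * (w z * h z)) ∂μ‖ ≤
      m * ((2 * (R + 1) + 1) * ‖y‖) ^ 2 := by
    refine (norm_integral_le_of_norm_le ?_ (Eventually.of_forall hpt)).trans ?_
    · exact IntegrableOn.integrable_indicator
        (continuousOn_const.integrableOn_compact (isCompact_closedBall _ _)) measurableSet_closedBall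
    · rw [integral_indicator measurableSet_closedBall, setIntegral_const, smul_eq_mul]
  have hinner : ∫ z, w z * inner ℝ z y ∂μ = inner ℝ (∫ z, w z • z ∂μ) y := by
    rw [real_inner_comm, ← integral_inner hwzi]
    refine integral_congr_ae (Eventually.of_forall fun z => ?_)
    simp only
    rw [inner_smul_right, real_inner_comm]
  have hwin : Integrable (fun z => w z * inner ℝ z y) μ :=
    (by fun_prop : Continuous fun z => w z * inner ℝ z y).integrable_of_hasCompactSupport
      hws.mul_right
  have hval : ∫ z, (w (z - y) ^ 2 - w z ^ 2 - 2 * (w z * h z)) ∂μ =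
      -(4 * inner ℝ (∫ z, w z • z ∂μ) y) + 2 * (∫ z, w z ∂μ) * ‖y‖ ^ 2 := by
    rw [integral_sub (f := fun z => w (z - y) ^ 2 - w z ^ 2) (hFy.sub hF) (hwh.const_mul 2),
      integral_sub hFy hF, heq, sub_self, zero_sub,
      integral_const_mul]
    have : ∀ z, w z * h z = 2 * (w z * inner ℝ z y) - w z * ‖y‖ ^ 2 := fun z => by
      rw [hh]; ring
    simp_rw [this]
    rw [integral_sub (hwin.const_mul 2) (hwi.mul_const _), integral_const_mul, integral_mul_const,
      hinner]
    ring
  rw [hval, Real.norm_eq_abs, abs_le] at hbound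
  have hW : 0 ≤ (∫ z, w z ∂μ) * ‖y‖ ^ 2 :=
    mul_nonneg (integral_nonneg hw0) (sq_nonneg _)
  rw [abs_le]
  constructor <;> nlinarith [hbound.1, hbound.2]

/-- `S` is, in some ball centred on it, `ε`-close to an affine `n`-plane. -/
def FlatSomewhere {d : ℕ} (n : ℕ) (ε : ℝ) (S : Set (Euc d)) : Prop :=
  ∃ y ∈ S, ∃ ρ : ℝ, 0 < ρ ∧ ∃ (q : Euc d) (W : Submodule ℝ (Euc d)), Module.finrank ℝ W = n ∧
    ∀ z ∈ S, dist z y ≤ ρ → ∃ w ∈ W, dist z (q + w) ≤ ε * ρ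

/-- A measure is `n`-uniform if balls of radius `r` centred on its support have mass `r ^ n`. -/
def IsUniformPow {d : ℕ} (n : ℕ) (ν : Measure (Euc d)) : Prop :=
  ∀ x ∈ msupport ν, ∀ r : ℝ, 0 < r → ν (closedBall x r) = ENNReal.ofReal (r ^ n)

lemma IsUniformPow.isDistributionFunction {d n : ℕ} {ν : Measure (Euc d)} (h : IsUniformPow n ν)
    (hne : (msupport ν).Nonempty) :
    IsDistributionFunction ν (fun r => ENNReal.ofReal (r ^ n)) :=
  ⟨hne, fun r hr => ⟨ENNReal.ofReal_pos.2 (by positivity), ENNReal.ofReal_lt_top⟩, h⟩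

lemma hasDim0_ofReal_pow (n : ℕ) : HasDim0 (fun r => ENNReal.ofReal (r ^ n)) n := by
  refine ⟨1, one_pos, tendsto_const_nhds.congr' ?_⟩
  filter_upwards [self_mem_nhdsWithin] with r hr
  have hr' : (0 : ℝ) < r := hr
  rw [ENNReal.toReal_ofReal (by positivity), div_self (by positivity)]

/-- Flatness of a limit set passes to the approximating rescaled sets. -/
lemma exists_flat_of_limit {d n : ℕ} (ω : Ultrafilter ℕ) {S T : Set (Euc d)} {x : ℕ → Euc d}
    {s : ℕ → ℝ} (hs : ∀ j, 0 < s j)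
    (hT : ∀ z, z ∈ T ↔ ∃ u : ℕ → Euc d, (∀ j, x j + s j • u j ∈ S) ∧ Tendsto u ω (𝓝 z))
    {ε : ℝ} (hε : 0 < ε) (hflat : FlatSomewhere n ε T) :
    ∃ (y : Euc d) (u : ℕ → Euc d) (ρ : ℝ) (W : Submodule ℝ (Euc d)), 0 < ρ ∧
      Module.finrank ℝ W = n ∧ Tendsto u ω (𝓝 y) ∧ (∀ j, x j + s j • u j ∈ S) ∧
      ∀ᶠ j in (ω : Filter ℕ), ∃ q : Euc d, ∀ z ∈ S, dist z (x j + s j • u j) ≤ s j * ρ →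
        ∃ w ∈ W, dist z (q + w) ≤ 2 * ε * (s j * ρ) := by
  obtain ⟨y, hy, ρ, hρ, q, W, hW, hclose⟩ := hflat
  obtain ⟨u, hu, huy⟩ := (hT y).1 hy
  refine ⟨y, u, ρ, W, hρ, hW, huy, hu, ?_⟩
  suffices h : ∀ᶠ j in (ω : Filter ℕ), ∀ v : Euc d, x j + s j • v ∈ S → dist v (u j) ≤ ρ →
      ∃ w ∈ W, dist v (q + w) ≤ 2 * ε * ρ by
    filter_upwards [h] with j hj
    have hsj := hs j
    refine ⟨x j + s j • q, fun z hz hzd => ?_⟩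
    set v := (s j)⁻¹ • (z - x j) with hv
    have hzv : z = x j + s j • v := by
      rw [hv, smul_inv_smul₀ hsj.ne']
      abel
    rw [hzv, dist_add_left, dist_smul₀, Real.norm_of_nonneg hsj.le,
      mul_le_mul_iff_right₀ hsj] at hzd
    obtain ⟨w, hw, hwd⟩ := hj v (hzv ▸ hz) hzd
    refine ⟨s j • w, W.smul_mem _ hw, ?_⟩
    rw [hzv, add_assoc, dist_add_left, ← smul_add, dist_smul₀, Real.norm_of_nonneg hsj.le]
    calc s j * dist v (q + w) ≤ s j * (2 * ε * ρ) := by gcongr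
      _ = 2 * ε * (s j * ρ) := by ring
  by_contra hcon
  rw [← Ultrafilter.eventually_not] at hcon
  have hex : ∀ j, ∃ v : Euc d, x j + s j • v ∈ S ∧
      ((¬ ∀ v : Euc d, x j + s j • v ∈ S → dist v (u j) ≤ ρ →
        ∃ w ∈ W, dist v (q + w) ≤ 2 * ε * ρ) →
      dist v (u j) ≤ ρ ∧ ∀ w ∈ W, 2 * ε * ρ < dist v (q + w)) := by
    intro j
    by_cases h : ∀ v : Euc d, x j + s j • v ∈ S → dist v (u j) ≤ ρ →
        ∃ w ∈ W, dist v (q + w) ≤ 2 * ε * ρ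
    · exact ⟨u j, hu j, fun h' => absurd h h'⟩
    · have h' := h
      push Not at h'
      obtain ⟨v, hv1, hv2, hv3⟩ := h'
      exact ⟨v, hv1, fun _ => ⟨hv2, hv3⟩⟩
  choose v hvS hv using hex
  have hvb : ∀ᶠ j in (ω : Filter ℕ), v j ∈ closedBall y (ρ + 1) := by
    filter_upwards [hcon, huy.eventually (closedBall_mem_nhds y one_pos)] with j hj hj'
    rw [mem_closedBall]
    exact (dist_triangle _ (u j) _).trans (add_le_add (hv j hj).1 hj')
  obtain ⟨v₀, -, hv₀⟩ := (isCompact_closedBall y (ρ + 1)).ultrafilter_le_nhds' (ω.map v) hvb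
  have hv₀t : Tendsto v ω (𝓝 v₀) := hv₀
  have hv₀T : v₀ ∈ T := (hT v₀).2 ⟨v, hvS, hv₀t⟩
  have hv₀y : dist v₀ y ≤ ρ := le_of_tendsto (hv₀t.dist huy) (hcon.mono fun j hj => (hv j hj).1)
  obtain ⟨w, hw, hwd⟩ := hclose v₀ hv₀T hv₀y
  have : 2 * ε * ρ ≤ dist v₀ (q + w) :=
    ge_of_tendsto (hv₀t.dist tendsto_const_nhds) (hcon.mono fun j hj => ((hv j hj).2 w hw).le)
  have : 0 < ε * ρ := by positivity
  linarith

lemma flatSomewhere_of_limit {d n : ℕ} (ω : Ultrafilter ℕ) {S T : Set (Euc d)} {x : ℕ → Euc d}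
    {s : ℕ → ℝ} (hs : ∀ j, 0 < s j)
    (hT : ∀ z, z ∈ T ↔ ∃ u : ℕ → Euc d, (∀ j, x j + s j • u j ∈ S) ∧ Tendsto u ω (𝓝 z))
    (hflat : ∀ ε : ℝ, 0 < ε → FlatSomewhere n ε T) :
    ∀ ε : ℝ, 0 < ε → FlatSomewhere n ε S := by
  intro ε hε
  obtain ⟨y, u, ρ, W, hρ, hW, -, hu, hev⟩ :=
    exists_flat_of_limit ω hs hT (half_pos hε) (hflat _ (half_pos hε))
  obtain ⟨j, q, hq⟩ := hev.exists
  refine ⟨_, hu j, s j * ρ, mul_pos (hs j) hρ, q, W, hW, fun z hz hzd => ?_⟩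
  obtain ⟨w, hw, hwd⟩ := hq z hz hzd
  exact ⟨w, hw, by linarith⟩

/-- Blow-up of an `n`-uniform measure at a point of its support. -/
lemma IsUniformPow.exists_tangent {d n : ℕ} (ω : Ultrafilter ℕ) {ν : Measure (Euc d)}
    [IsLocallyFiniteMeasure ν] (h : IsUniformPow n ν) {y : Euc d} (hy : y ∈ msupport ν)
    {s : ℕ → ℝ} (hs : ∀ j, 0 < s j) (hs0 : Tendsto s ω (𝓝 0)) :
    ∃ ν' : Measure (Euc d), IsLocallyFiniteMeasure ν' ∧ IsUniformPow n ν' ∧ 0 ∈ msupport ν' ∧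
      ∀ z, z ∈ msupport ν' ↔ ∃ u : ℕ → Euc d, (∀ j, y + s j • u j ∈ msupport ν) ∧
        Tendsto u ω (𝓝 z) := by
  obtain ⟨ν', h1, h2, h3⟩ := exists_blowup ω ν (h.isDistributionFunction ⟨y, hy⟩)
    (hasDim0_ofReal_pow n) (x := fun _ => y) (fun _ => hy) hs hs0
  exact ⟨ν', h1, h2, (h3 0).2 ⟨fun _ => 0, fun j => by simpa using hy, tendsto_const_nhds⟩, h3⟩

lemma subset_submodule_of_limit {d : ℕ} {ω : Ultrafilter ℕ} {S T : Set (Euc d)} {y : Euc d}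
    {s : ℕ → ℝ} (hs : ∀ j, 0 < s j)
    (hT : ∀ z, z ∈ T ↔ ∃ u : ℕ → Euc d, (∀ j, y + s j • u j ∈ S) ∧ Tendsto u ω (𝓝 z))
    {V : Submodule ℝ (Euc d)} (hyV : y ∈ V) (hS : S ⊆ V) : T ⊆ V := by
  intro z hz
  obtain ⟨u, hu, huz⟩ := (hT z).1 hz
  refine V.closed_of_finiteDimensional.mem_of_tendsto huz (Eventually.of_forall fun j => ?_)
  have h1 : s j • u j ∈ V := (V.add_mem_iff_right hyV).1 (hS (hu j))
  exact (V.smul_mem_iff (hs j).ne').1 h1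

/-- A blow-up at a point nearest to a point `a` off the set lies in a half-space. -/
lemma inner_nonpos_of_limit {d : ℕ} {ω : Ultrafilter ℕ} {S T : Set (Euc d)} {a y : Euc d}
    {s : ℕ → ℝ} (hs : ∀ j, 0 < s j) (hs0 : Tendsto s ω (𝓝 0))
    (hT : ∀ z, z ∈ T ↔ ∃ u : ℕ → Euc d, (∀ j, y + s j • u j ∈ S) ∧ Tendsto u ω (𝓝 z))
    (hnear : ∀ z ∈ S, dist a y ≤ dist a z) : ∀ z ∈ T, inner ℝ z (a - y) ≤ 0 := by
  intro z hz
  obtain ⟨u, hu, huz⟩ := (hT z).1 hz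
  have h1 : Tendsto (fun j => s j * ‖u j‖ ^ 2) ω (𝓝 0) := by
    simpa using hs0.mul (huz.norm.pow 2)
  have h2 : Tendsto (fun j => 2 * inner ℝ (u j) (a - y)) ω (𝓝 (2 * inner ℝ z (a - y))) :=
    (huz.inner tendsto_const_nhds).const_mul 2
  have h3 : 2 * inner ℝ z (a - y) ≤ 0 := by
    refine le_of_tendsto_of_tendsto' h2 h1 fun j => ?_
    have h := hnear _ (hu j)
    rw [dist_eq_norm, dist_eq_norm, ← sub_sub] at h
    have h' := pow_le_pow_left₀ (norm_nonneg _) h 2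
    rw [norm_sub_sq_real (a - y) (s j • u j), inner_smul_right, norm_smul, mul_pow,
      Real.norm_of_nonneg (hs j).le, real_inner_comm] at h'
    have h4 : 0 ≤ s j * (s j * ‖u j‖ ^ 2 - 2 * inner ℝ (u j) (a - y)) := by linarith
    have := nonneg_of_mul_nonneg_right h4 (hs j)
    linarith
  linarith

/-- A blow-up at the origin of a set almost orthogonal to `b` is orthogonal to `b`. -/
lemma inner_eq_zero_of_limit {d : ℕ} {ω : Ultrafilter ℕ} {S T : Set (Euc d)} {b : Euc d}
    {C : ℝ} {s : ℕ → ℝ} (hs : ∀ j, 0 < s j) (hs0 : Tendsto s ω (𝓝 0))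
    (hT : ∀ z, z ∈ T ↔ ∃ u : ℕ → Euc d, (∀ j, 0 + s j • u j ∈ S) ∧ Tendsto u ω (𝓝 z))
    (hb : ∀ y ∈ S, ‖y‖ ≤ 1 → |inner ℝ b y| ≤ C * ‖y‖ ^ 2) : ∀ z ∈ T, inner ℝ b z = 0 := by
  intro z hz
  obtain ⟨u, hu, huz⟩ := (hT z).1 hz
  have h1 : Tendsto (fun j => C * (s j * ‖u j‖ ^ 2)) ω (𝓝 0) := by
    simpa using (hs0.mul (huz.norm.pow 2)).const_mul C
  have h2 : Tendsto (fun j => |inner ℝ b (u j)|) ω (𝓝 |inner ℝ b z|) :=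
    (tendsto_const_nhds.inner huz).abs
  have h3 : Tendsto (fun j => ‖s j • u j‖) ω (𝓝 0) := by
    simpa using (hs0.smul huz).norm
  have h4 : |inner ℝ b z| ≤ 0 := by
    refine le_of_tendsto_of_tendsto h2 h1 ?_
    filter_upwards [h3.eventually_le_const one_pos] with j hj
    have h := hb _ (by simpa using hu j) hj
    rw [inner_smul_right, abs_mul, abs_of_pos (hs j), norm_smul, mul_pow,
      Real.norm_of_nonneg (hs j).le] at h
    refine le_of_mul_le_mul_left ?_ (hs j)
    linarith
  exact abs_nonpos_iff.1 h4

/-- The weighted barycentre of a measure carried by a half-space, but not by its boundary, is in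
the open half-space. -/
lemma inner_barycenter_neg {d : ℕ} (μ : Measure (Euc d)) [IsLocallyFiniteMeasure μ] {e : Euc d}
    (he : ∀ z ∈ msupport μ, inner ℝ z e ≤ 0) {z₀ : Euc d} (hz₀ : z₀ ∈ msupport μ)
    (hz₀e : inner ℝ z₀ e ≠ 0) {R : ℝ} (hR : ‖z₀‖ < R) :
    inner ℝ (∫ z, max (R ^ 2 - ‖z‖ ^ 2) 0 • z ∂μ) e < 0 := by
  have hR0 : 0 < R := (norm_nonneg _).trans_lt hR
  set w : Euc d → ℝ := fun z => max (R ^ 2 - ‖z‖ ^ 2) 0 with hw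
  have hwc : Continuous w := by fun_prop
  have hwR : ∀ z ∉ closedBall (0 : Euc d) R, w z = 0 := by
    intro z hz
    rw [mem_closedBall_zero_iff, not_le] at hz
    exact max_eq_right (by nlinarith)
  have hws : HasCompactSupport w := HasCompactSupport.intro (isCompact_closedBall 0 R) hwR
  have hwzi : Integrable (fun z => w z • z) μ :=
    (by fun_prop : Continuous fun z => w z • z).integrable_of_hasCompactSupport hws.smul_right
  have hfc : Continuous fun z => -(w z * inner ℝ z e) := by fun_prop
  have hfi : Integrable (fun z => -(w z * inner ℝ z e)) μ :=
    ((by fun_prop : Continuous fun z => w z * inner ℝ z e).integrable_of_hasCompactSupport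
      hws.mul_right).neg
  have hinner : inner ℝ (∫ z, w z • z ∂μ) e = -∫ z, -(w z * inner ℝ z e) ∂μ := by
    rw [real_inner_comm, ← integral_inner hwzi, integral_neg, neg_neg]
    refine integral_congr_ae (Eventually.of_forall fun z => ?_)
    simp only
    rw [inner_smul_right, real_inner_comm]
  rw [hinner, neg_lt_zero, integral_pos_iff_support_of_nonneg_ae _ hfi]
  · have hmem : z₀ ∈ Function.support fun z => -(w z * inner ℝ z e) := by
      rw [Function.mem_support]
      refine neg_ne_zero.2 (mul_ne_zero (ne_of_gt ?_) hz₀e)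
      refine lt_max_of_lt_left ?_
      have := norm_nonneg z₀
      nlinarith
    obtain ⟨δ, hδ, hsub⟩ := nhds_basis_closedBall.mem_iff.1
      (hfc.isOpen_support.mem_nhds hmem)
    exact (hz₀ δ hδ).trans_le (measure_mono hsub)
  · filter_upwards [ae_mem_msupport μ] with z hz
    exact neg_nonneg.2 (mul_nonpos_of_nonneg_of_nonpos (le_max_right _ _) (he z hz))

/-- An `n`-uniform measure is arbitrarily flat in some ball centred on its support. -/
lemma IsUniformPow.flatSomewhere_of_subset {d n : ℕ} (k : ℕ) :
    ∀ (V : Submodule ℝ (Euc d)), Module.finrank ℝ V = k → ∀ (ν : Measure (Euc d))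
      [IsLocallyFiniteMeasure ν], IsUniformPow n ν → 0 ∈ msupport ν → msupport ν ⊆ V →
      ∀ ε : ℝ, 0 < ε → FlatSomewhere n ε (msupport ν) := by
  induction k using Nat.strong_induction_on with
  | _ k ih =>
  intro V hVk ν _ hν h0 hνV
  have hcut : ∀ (b e : Euc d), e ∈ V → inner ℝ b e ≠ 0 → ∀ (ν : Measure (Euc d))
      [IsLocallyFiniteMeasure ν], IsUniformPow n ν → 0 ∈ msupport ν → msupport ν ⊆ V →
      (∀ z ∈ msupport ν, inner ℝ b z = 0) →
      ∀ ε : ℝ, 0 < ε → FlatSomewhere n ε (msupport ν) := by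
    intro b e he hbe ν _ hν h0 hνV hb
    have hlt : V ⊓ (ℝ ∙ b)ᗮ < V := by
      refine lt_of_le_of_ne inf_le_left fun h => hbe ?_
      have he' : e ∈ V ⊓ (ℝ ∙ b)ᗮ := h.ge he
      exact Submodule.mem_orthogonal_singleton_iff_inner_right.1 he'.2
    exact ih _ (hVk ▸ Submodule.finrank_lt_finrank_of_lt hlt) _ rfl ν hν h0 fun z hz =>
      Submodule.mem_inf.2
        ⟨hνV hz, Submodule.mem_orthogonal_singleton_iff_inner_right.2 (hb z hz)⟩
  by_cases hfull : (V : Set (Euc d)) ⊆ msupport ν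
  · intro ε hε
    have hV : msupport ν = V := hνV.antisymm hfull
    refine ⟨0, h0, 1, one_pos, 0, V, finrank_eq_of_msupport_eq ν hν V hV, fun z hz _ => ?_⟩
    exact ⟨z, hνV hz, by simpa using hε.le⟩
  · obtain ⟨a, haV, haν⟩ := not_subset.1 hfull
    obtain ⟨y, hy, hya⟩ := (isClosed_msupport ν).exists_infDist_eq_dist ⟨0, h0⟩ a
    have hnear : ∀ z ∈ msupport ν, dist a y ≤ dist a z := fun z hz =>
      hya ▸ infDist_le_dist_of_mem hz
    have heV : a - y ∈ V := V.sub_mem haV (hνV hy)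
    have he0 : a - y ≠ 0 := fun h => haν (sub_eq_zero.1 h ▸ hy)
    let ω : Ultrafilter ℕ := hyperfilter ℕ
    let s : ℕ → ℝ := fun j => 1 / ((j : ℝ) + 1)
    have hs : ∀ j, 0 < s j := fun j => Nat.one_div_pos_of_nat
    have hs0 : Tendsto s ω (𝓝 0) :=
      tendsto_one_div_add_atTop_nhds_zero_nat.mono_left Nat.hyperfilter_le_atTop
    obtain ⟨ν', _, hν', h0', hT'⟩ := hν.exists_tangent ω hy hs hs0
    have hν'V := subset_submodule_of_limit hs hT' (hνV hy) hνV
    have hhalf := inner_nonpos_of_limit hs hs0 hT' hnear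
    refine flatSomewhere_of_limit ω hs hT' ?_
    by_cases hz : ∀ z ∈ msupport ν', inner ℝ (a - y) z = 0
    · exact hcut (a - y) (a - y) heV (inner_self_ne_zero.2 he0) ν' hν' h0' hν'V hz
    · push Not at hz
      obtain ⟨z₀, hz₀, hz₀e⟩ := hz
      rw [real_inner_comm] at hz₀e
      have hR : ‖z₀‖ < ‖z₀‖ + 1 := lt_add_one _
      have hbneg := inner_barycenter_neg ν' hhalf hz₀ hz₀e hR
      obtain ⟨C, hC⟩ := exists_barycenter_bound ν' (φ := fun r => ENNReal.ofReal (r ^ n)) hν' h0'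
        (R := ‖z₀‖ + 1) (by positivity)
      obtain ⟨ν'', _, hν'', h0'', hT''⟩ := hν'.exists_tangent ω h0' hs hs0
      refine flatSomewhere_of_limit ω hs hT'' ?_
      exact hcut _ (a - y) heV hbneg.ne ν'' hν'' h0''
        (subset_submodule_of_limit hs hT'' V.zero_mem hν'V)
        (inner_eq_zero_of_limit hs hs0 hT'' hC)

lemma IsUniformPow.flatSomewhere {d n : ℕ} {ν : Measure (Euc d)} [IsLocallyFiniteMeasure ν]
    (hν : IsUniformPow n ν) (h0 : 0 ∈ msupport ν) {ε : ℝ} (hε : 0 < ε) :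
    FlatSomewhere n ε (msupport ν) :=
  hν.flatSomewhere_of_subset _ ⊤ rfl ν h0 (fun _ _ => Submodule.mem_top) ε hε

/-- Balls centred on the support, of bounded radius, contain flat balls of comparable radius. -/
lemma exists_flat_ball {d n : ℕ} (μ : Measure (Euc d)) [IsLocallyFiniteMeasure μ]
    {φ : ℝ → ENNReal} (hφ : IsDistributionFunction μ φ) (hn : HasDim0 φ n)
    {ε : ℝ} (hε : 0 < ε) (R : ℝ) :
    ∃ τ : ℝ, 0 < τ ∧ ∀ x ∈ msupport μ, ∀ r : ℝ, 0 < r → r ≤ R →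
      ∃ x' ∈ msupport μ, ∃ r' : ℝ, τ * r ≤ r' ∧ closedBall x' r' ⊆ closedBall x r ∧
        ∃ (q : Euc d) (W : Submodule ℝ (Euc d)), Module.finrank ℝ W = n ∧
          ∀ z ∈ msupport μ, dist z x' ≤ r' → ∃ w ∈ W, dist z (q + w) ≤ ε * r' := by
  by_contra! hcon
  have hj : ∀ j : ℕ, (0 : ℝ) < (j : ℝ) + 1 := fun j => by positivity
  choose x hx r hr hrR hbad using fun j : ℕ =>
    hcon ((((j : ℝ) + 1) ^ 2)⁻¹) (inv_pos.2 (pow_pos (hj j) 2))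
  set s : ℕ → ℝ := fun j => r j / ((j : ℝ) + 1) with hs_def
  have hs : ∀ j, 0 < s j := fun j => div_pos (hr j) (hj j)
  have hlim : Tendsto (fun j : ℕ => (j : ℝ) + 1) atTop atTop :=
    tendsto_atTop_add_const_right _ _ tendsto_natCast_atTop_atTop
  have hs0 : Tendsto s atTop (𝓝 0) :=
    squeeze_zero (fun j => (hs j).le)
      (fun j => div_le_div_of_nonneg_right (hrR j) (hj j).le) (hlim.const_div_atTop R)
  have hω : ((hyperfilter ℕ : Ultrafilter ℕ) : Filter ℕ) ≤ atTop :=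
    Nat.hyperfilter_le_atTop
  obtain ⟨ν, hlf, hν, hsupp⟩ := exists_blowup (hyperfilter ℕ) μ hφ hn hx hs (hs0.mono_left hω)
  have h0 : (0 : Euc d) ∈ msupport ν :=
    (hsupp 0).2 ⟨fun _ => 0, fun j => by simpa using hx j, tendsto_const_nhds⟩
  have hflat : FlatSomewhere n (ε / 2) (msupport ν) :=
    IsUniformPow.flatSomewhere hν h0 (half_pos hε)
  obtain ⟨y, u, ρ, W, hρ, hW, huy, hu, hev⟩ :=
    exists_flat_of_limit (hyperfilter ℕ) hs hsupp (half_pos hε) hflat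
  have h1 : ∀ᶠ j in ((hyperfilter ℕ : Ultrafilter ℕ) : Filter ℕ), ‖u j‖ < ‖y‖ + 1 :=
    huy.norm.eventually_lt_const (by linarith)
  have h2 := (hlim.eventually_ge_atTop (‖y‖ + 1 + ρ)).filter_mono hω
  have h3 := (hlim.eventually_ge_atTop ρ⁻¹).filter_mono hω
  obtain ⟨j, ⟨q, hq⟩, hj1, hj2, hj3⟩ := (hev.and (h1.and (h2.and h3))).exists
  have hrs : r j = s j * ((j : ℝ) + 1) := (div_mul_cancel₀ _ (hj j).ne').symm
  have hτ : (((j : ℝ) + 1) ^ 2)⁻¹ * r j ≤ s j * ρ := by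
    have h : ((j : ℝ) + 1)⁻¹ ≤ ρ := inv_le_of_inv_le₀ hρ hj3
    have e : (((j : ℝ) + 1) ^ 2)⁻¹ * r j = s j * ((j : ℝ) + 1)⁻¹ := by
      simp only [hs_def]
      field_simp
    rw [e]
    exact mul_le_mul_of_nonneg_left h (hs j).le
  have hsub : closedBall (x j + s j • u j) (s j * ρ) ⊆ closedBall (x j) (r j) := by
    refine closedBall_subset_closedBall' ?_
    rw [dist_eq_norm, add_sub_cancel_left, norm_smul, Real.norm_of_nonneg (hs j).le, hrs,
      ← mul_add]
    exact mul_le_mul_of_nonneg_left (by linarith) (hs j).le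
  obtain ⟨z, hz, hzd, hzw⟩ := hbad j _ (hu j) _ hτ hsub q W hW
  obtain ⟨w, hw, hwd⟩ := hq z hz hzd
  have := hzw w hw
  rw [mul_div_cancel₀ ε two_ne_zero] at hwd
  linarith

lemma jonesBeta_le_of_submodule {d n : ℕ} {μ : Measure (Euc d)} {x : Euc d} {r ε : ℝ}
    (hr : 0 < r) (hε : 0 ≤ ε) {q : Euc d} {W : Submodule ℝ (Euc d)}
    (hW : Module.finrank ℝ W = n)
    (h : ∀ z ∈ msupport μ, dist z x ≤ r → ∃ w ∈ W, dist z (q + w) ≤ ε * r) :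
    jonesBeta n μ x r ≤ ε := by
  have hL : AffineSubspace.mk' q W ∈ nPlanes d n :=
    ⟨⟨q, AffineSubspace.self_mem_mk' q W⟩, by rw [AffineSubspace.direction_mk', hW]⟩
  refine (ciInf_le ⟨0, ?_⟩ (⟨_, hL⟩ : nPlanes d n)).trans (Real.iSup_le ?_ hε)
  · rintro _ ⟨L, rfl⟩
    exact Real.iSup_nonneg fun y => div_nonneg infDist_nonneg hr.le
  · rintro ⟨z, hz, hzx⟩
    obtain ⟨w, hw, hwd⟩ := h z hz hzx
    rw [div_le_iff₀ hr]
    refine (infDist_le_dist_of_mem ?_).trans hwd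
    rw [SetLike.mem_coe, AffineSubspace.mem_mk', vsub_eq_sub, add_sub_cancel_left]
    exact hw

lemma radius_le_of_closedBall_subset {d : ℕ} (hd : 0 < d) {x : Euc d} {r M : ℝ} (hr : 0 ≤ r)
    (h : closedBall x r ⊆ closedBall 0 M) : r ≤ M := by
  let e : Euc d := EuclideanSpace.single ⟨0, hd⟩ (1 : ℝ)
  have he : ‖e‖ = 1 := by simp [e]
  have h1 : ‖x + r • e‖ ≤ M := by
    simpa using h (show x + r • e ∈ closedBall x r by
      simp [norm_smul, he, abs_of_nonneg hr])
  have h2 : ‖x - r • e‖ ≤ M := by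
    simpa using h (show x - r • e ∈ closedBall x r by
      simp [norm_smul, he, abs_of_nonneg hr])
  have h3 : ‖(x + r • e) - (x - r • e)‖ = 2 * r := by
    rw [show (x + r • e) - (x - r • e) = (2 * r) • e by module, norm_smul, he, mul_one,
      Real.norm_of_nonneg (by positivity)]
  linarith [norm_sub_le (x + r • e) (x - r • e)]

theorem existence_of_big_flat_balls {d n p : ℕ}
    (μ : Measure (Euc d)) [IsLocallyFiniteMeasure μ]
    (φ : ℝ → ENNReal) (hφ : IsDistributionFunction μ φ)
    (hn : HasDim0 φ n) (hp : HasDimInfty φ p)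
    (K : Set (Euc d)) (hK : IsCompact K) :
    ∀ ε : ℝ, 0 < ε → ∃ τ : ℝ, 0 < τ ∧
      ∀ x ∈ msupport μ, ∀ r : ℝ, 0 < r → Metric.closedBall x r ⊆ K →
        ∃ x' ∈ msupport μ, ∃ r' : ℝ, τ * r ≤ r' ∧
          Metric.closedBall x' r' ⊆ Metric.closedBall x r ∧
          jonesBeta n μ x' r' ≤ ε := by
  intro ε hε
  rcases Nat.eq_zero_or_pos d with rfl | hd
  · obtain ⟨τ, -, h⟩ := exists_flat_ball μ hφ hn hε 1
    obtain ⟨x₀, hx₀⟩ := hφ.1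
    obtain ⟨-, -, -, -, -, -, W, hW, -⟩ := h x₀ hx₀ 1 one_pos le_rfl
    refine ⟨1, one_pos, fun x hx r hr _ => ⟨x, hx, r, (one_mul r).le, Subset.rfl,
      jonesBeta_le_of_submodule (q := 0) hr hε.le hW fun z _ _ => ⟨0, W.zero_mem, ?_⟩⟩⟩
    rw [Subsingleton.elim z (0 + 0), dist_self]
    positivity
  · obtain ⟨M, hM⟩ := hK.isBounded.subset_closedBall 0
    obtain ⟨τ, hτ, h⟩ := exists_flat_ball μ hφ hn hε M
    refine ⟨τ, hτ, fun x hx r hr hxK => ?_⟩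
    obtain ⟨x', hx', r', hr', hsub, q, W, hW, hflat⟩ :=
      h x hx r hr (radius_le_of_closedBall_subset hd hr.le (hxK.trans hM))
    exact ⟨x', hx', r', hr', hsub,
      jonesBeta_le_of_submodule ((mul_pos hτ hr).trans_le hr') hε.le hW hflat⟩
end
end

section
/- Let μ be a uniformly distributed measure on ℝ^d. Then μ(B(x,2r)) ≤ 10^d μ(B(x,r)) for every x ∈ supp μ and every r > 0; in particular μ is doubling. -/
open MeasureTheory Metric Filter Set

noncomputable section

/-- The complement of the support is null. -/
theorem measure_compl_msupport {d : ℕ} (μ : Measure (Euc d)) : μ (msupport μ)ᶜ = 0 := by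
  refine measure_null_of_locally_null _ fun x hx => ?_
  simp only [msupport, mem_compl_iff, mem_ofPred_eq, not_forall, not_lt, nonpos_iff_eq_zero] at hx
  obtain ⟨r, hr, h⟩ := hx
  exact ⟨closedBall x r, mem_nhdsWithin_of_mem_nhds (closedBall_mem_nhds x hr), h⟩

/-- An `r`-separated subset of a closed ball of radius `2 * r` has at most `5 ^ d` points. -/
theorem card_le_of_separated_closedBall {d : ℕ} {x : Euc d} {r : ℝ} (hr : 0 < r)
    (s : Finset (Euc d)) (hs : ∀ y ∈ s, y ∈ closedBall x (2 * r))
    (hsep : ∀ y ∈ s, ∀ z ∈ s, y ≠ z → r ≤ dist y z) : s.card ≤ 5 ^ d := by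
  classical
  have hinj : Function.Injective fun y : Euc d => r⁻¹ • (y - x) := fun y z h =>
    sub_left_injective (smul_right_injective _ (inv_ne_zero hr.ne') h)
  rw [← Finset.card_image_of_injective s hinj]
  refine (Besicovitch.card_le_of_separated (E := Euc d) _ ?_ ?_).trans_eq (by simp)
  · intro c hc
    obtain ⟨y, hy, rfl⟩ := Finset.mem_image.1 hc
    rw [norm_smul, norm_inv, Real.norm_of_nonneg hr.le, inv_mul_le_iff₀ hr, ← dist_eq_norm,
      mul_comm]
    exact hs y hy
  · intro c hc e he hne
    obtain ⟨y, hy, rfl⟩ := Finset.mem_image.1 hc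
    obtain ⟨z, hz, rfl⟩ := Finset.mem_image.1 he
    rw [← smul_sub, sub_sub_sub_cancel_right, norm_smul, norm_inv, Real.norm_of_nonneg hr.le,
      le_inv_mul_iff₀ hr, mul_one, ← dist_eq_norm]
    exact hsep y hy z hz fun h => hne (by rw [h])

/-- Every subset of a closed ball of radius `2 * r` is covered by at most `5 ^ d` closed balls of
radius `r` centred in it. -/
theorem exists_finset_cover_closedBall {d : ℕ} {x : Euc d} {r : ℝ} (hr : 0 < r)
    {A : Set (Euc d)} (hA : A ⊆ closedBall x (2 * r)) :
    ∃ s : Finset (Euc d), ↑s ⊆ A ∧ s.card ≤ 5 ^ d ∧ A ⊆ ⋃ y ∈ s, closedBall y r := by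
  classical
  let P : ℕ → Prop := fun n => ∃ s : Finset (Euc d), ↑s ⊆ A ∧
    (∀ y ∈ s, ∀ z ∈ s, y ≠ z → r ≤ dist y z) ∧ s.card = n
  have hbound : ∀ n, P n → n ≤ 5 ^ d := by
    rintro n ⟨s, hsA, hsep, rfl⟩
    exact card_le_of_separated_closedBall hr s (fun y hy => hA (hsA hy)) hsep
  have hP0 : P 0 := ⟨∅, by simp, by simp, rfl⟩
  obtain ⟨s, hsA, hsep, hcard⟩ := Nat.findGreatest_spec (Nat.zero_le (5 ^ d)) hP0
  refine ⟨s, hsA, hcard.trans_le (Nat.findGreatest_le _), fun a ha => ?_⟩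
  by_contra hcov
  simp only [mem_iUnion, mem_closedBall, not_exists, not_le] at hcov
  have has : a ∉ s := fun h => (hcov a h).not_ge (by simpa using hr.le)
  have hP : P (s.card + 1) := by
    refine ⟨insert a s, ?_, ?_, Finset.card_insert_of_notMem has⟩
    · rw [Finset.coe_insert]
      exact insert_subset ha hsA
    · intro y hy z hz hne
      rcases Finset.mem_insert.1 hy with rfl | hys <;>
        rcases Finset.mem_insert.1 hz with rfl | hzs
      · exact absurd rfl hne
      · exact (hcov z hzs).le
      · rw [dist_comm]
        exact (hcov y hys).le
      · exact hsep y hys z hzs hne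
  have hle := Nat.le_findGreatest (hbound _ hP) hP
  omega

/-- A uniformly distributed measure satisfies the doubling inequality with constant `5 ^ d`. -/
theorem UniformlyDistributed.measure_closedBall_two_mul_le {d : ℕ} {μ : Measure (Euc d)}
    (hμ : UniformlyDistributed μ) {x : Euc d} (hx : x ∈ msupport μ) {r : ℝ} (hr : 0 < r) :
    μ (closedBall x (2 * r)) ≤ 5 ^ d * μ (closedBall x r) := by
  obtain ⟨φ, -, -, hφ⟩ := hμ
  obtain ⟨s, hsA, hcard, hcov⟩ := exists_finset_cover_closedBall hr
    (inter_subset_left : closedBall x (2 * r) ∩ msupport μ ⊆ closedBall x (2 * r))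
  calc
    μ (closedBall x (2 * r)) = μ (closedBall x (2 * r) ∩ msupport μ) :=
      (measure_inter_conull (measure_compl_msupport μ)).symm
    _ ≤ μ (⋃ y ∈ s, closedBall y r) := measure_mono hcov
    _ ≤ ∑ y ∈ s, μ (closedBall y r) := measure_biUnion_finset_le s _
    _ = s.card * μ (closedBall x r) := by
      rw [Finset.sum_congr rfl fun y hy => (hφ y (hsA hy).2 r hr).trans (hφ x hx r hr).symm,
        Finset.sum_const, nsmul_eq_mul]
    _ ≤ 5 ^ d * μ (closedBall x r) := by
      gcongr
      exact_mod_cast hcard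

theorem uniformly_distributed_doubling {d : ℕ}
    (μ : Measure (Euc d)) [IsLocallyFiniteMeasure μ]
    (hμ : UniformlyDistributed μ) :
    (∀ x ∈ msupport μ, ∀ r : ℝ, 0 < r →
      μ (Metric.closedBall x (2 * r)) ≤ (10:ENNReal) ^ d * μ (Metric.closedBall x r)) ∧
    Doubling μ := by
  have hle : ∀ x ∈ msupport μ, ∀ r : ℝ, 0 < r →
      μ (closedBall x (2 * r)) ≤ (10 : ENNReal) ^ d * μ (closedBall x r) := fun x hx r hr =>
    (hμ.measure_closedBall_two_mul_le hx hr).trans (by gcongr; norm_num)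
  refine ⟨hle, 10 ^ d, by positivity, fun x hx r hr => ?_⟩
  rw [ENNReal.ofReal_pow (by norm_num), ENNReal.ofReal_ofNat]
  exact hle x hx r hr
end
end

section
/- Let μ be a uniformly distributed measure on ℝ^d with distribution function φ. Then for every x ∈ ℝ^d and all 0 < s < r < ∞, μ(B(x,r)) ≤ 5^d (r/s)^d φ(s). -/
open MeasureTheory Metric Filter Set

noncomputable section

theorem measure_support_subset_msupport {d : ℕ} (μ : Measure (Euc d)) :
    μ.support ⊆ msupport μ := by
  intro y hy t ht
  exact (Measure.mem_support_iff_forall y).1 hy _ (Metric.closedBall_mem_nhds y ht)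

/-- A ball of radius `t`, not necessarily centred on the support, has measure at most `φ (2 t)`. -/
theorem IsDistributionFunction.measure_closedBall_le {d : ℕ} {μ : Measure (Euc d)}
    {φ : ℝ → ENNReal} (hφ : IsDistributionFunction μ φ) (z : Euc d) {t : ℝ} (ht : 0 < t) :
    μ (Metric.closedBall z t) ≤ φ (2 * t) := by
  rcases eq_zero_or_pos (μ (Metric.closedBall z t)) with h | h
  · simp [h]
  · obtain ⟨y, hyz, hy⟩ := Measure.nonempty_inter_support_of_pos h
    rw [← hφ.2.2 y (measure_support_subset_msupport μ hy) (2 * t) (by positivity)]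
    refine measure_mono (Metric.closedBall_subset_closedBall' ?_)
    have := Metric.mem_closedBall'.1 hyz
    linarith

/-- If all balls of radius `t` have `μ`-measure at most `C`, then a volume comparison bounds the
`μ`-measure of larger balls. -/
theorem volume_closedBall_mul_measure_closedBall_le {d : ℕ} (μ : Measure (Euc d)) [SFinite μ]
    {t : ℝ} {C : ENNReal} (hC : ∀ z, μ (Metric.closedBall z t) ≤ C) (x : Euc d) (r : ℝ) :
    volume (Metric.closedBall (0 : Euc d) t) * μ (Metric.closedBall x r) ≤
      C * volume (Metric.closedBall x (r + t)) := by
  set S : Set (Euc d × Euc d) := {p | dist p.1 p.2 ≤ t ∧ dist p.2 x ≤ r}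
  have hSm : MeasurableSet S := by
    have h₁ : IsClosed {p : Euc d × Euc d | dist p.1 p.2 ≤ t} :=
      isClosed_le (by fun_prop) continuous_const
    have h₂ : IsClosed {p : Euc d × Euc d | dist p.2 x ≤ r} :=
      isClosed_le (by fun_prop) continuous_const
    exact (h₁.inter h₂).measurableSet
  calc volume (Metric.closedBall (0 : Euc d) t) * μ (Metric.closedBall x r)
      = ∫⁻ _ in Metric.closedBall x r, volume (Metric.closedBall (0 : Euc d) t) ∂μ := by
        rw [setLIntegral_const]
    _ ≤ ∫⁻ y, volume ((fun z => (z, y)) ⁻¹' S) ∂μ := by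
        rw [← lintegral_indicator Metric.isClosed_closedBall.measurableSet]
        refine lintegral_mono fun y => indicator_apply_le' (fun hy => ?_) fun _ => zero_le
        rw [← Measure.addHaar_closedBall_center volume y t]
        exact measure_mono fun z hz => ⟨hz, hy⟩
    _ = ∫⁻ z, μ (Prod.mk z ⁻¹' S) := by
        rw [← Measure.prod_apply_symm hSm, Measure.prod_apply hSm]
    _ ≤ ∫⁻ z, (Metric.closedBall x (r + t)).indicator (fun _ => C) z := by
        refine lintegral_mono fun z => ?_
        by_cases hz : z ∈ Metric.closedBall x (r + t)
        · rw [indicator_of_mem hz]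
          exact (measure_mono fun y hy => Metric.mem_closedBall'.2 hy.1).trans (hC z)
        · have h : Prod.mk z ⁻¹' S = ∅ := by
            refine eq_empty_of_forall_notMem fun y hy => hz ?_
            have h₁ : dist z y ≤ t := hy.1
            have h₂ : dist y x ≤ r := hy.2
            exact (dist_triangle z y x).trans (by linarith)
          simp [h]
    _ = C * volume (Metric.closedBall x (r + t)) := by
        rw [lintegral_indicator_const Metric.isClosed_closedBall.measurableSet]

theorem growth_bound_KiP {d : ℕ}
    (μ : Measure (Euc d)) [IsLocallyFiniteMeasure μ]
    (φ : ℝ → ENNReal) (hφ : IsDistributionFunction μ φ)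
    (x : Euc d) (s r : ℝ) (hs : 0 < s) (hsr : s < r) :
    μ (Metric.closedBall x r) ≤ ENNReal.ofReal (5 ^ d * (r / s) ^ d) * φ s := by
  have hr : 0 < r := hs.trans hsr
  have hbound : ∀ z, μ (Metric.closedBall z (s / 2)) ≤ φ s := fun z => by
    simpa [mul_div_cancel₀] using hφ.measure_closedBall_le z (half_pos hs)
  have key := volume_closedBall_mul_measure_closedBall_le μ hbound x r
  rw [Measure.addHaar_closedBall volume (0 : Euc d) (half_pos hs).le,
    Measure.addHaar_closedBall volume x (by positivity : 0 ≤ r + s / 2),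
    finrank_euclideanSpace_fin] at key
  set ω := volume (Metric.ball (0 : Euc d) 1)
  have hω0 : ω ≠ 0 := (Metric.measure_ball_pos volume _ one_pos).ne'
  have hωt : ω ≠ ⊤ := measure_ball_lt_top.ne
  have hs0 : ENNReal.ofReal ((s / 2) ^ d) ≠ 0 := by
    rw [Ne, ENNReal.ofReal_eq_zero, not_le]; positivity
  have hcoef : (r + s / 2) ^ d ≤ (s / 2) ^ d * (5 ^ d * (r / s) ^ d) := by
    rw [← mul_pow, ← mul_pow]
    have : s / 2 * (5 * (r / s)) = 5 * r / 2 := by field_simp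
    rw [this]
    gcongr
    linarith
  refine (ENNReal.mul_le_mul_iff_right (mul_ne_zero hs0 hω0)
    (ENNReal.mul_ne_top ENNReal.ofReal_ne_top hωt)).1 (key.trans ?_)
  calc φ s * (ENNReal.ofReal ((r + s / 2) ^ d) * ω)
      ≤ φ s * (ENNReal.ofReal ((s / 2) ^ d * (5 ^ d * (r / s) ^ d)) * ω) := by gcongr
    _ = ENNReal.ofReal ((s / 2) ^ d) * ω * (ENNReal.ofReal (5 ^ d * (r / s) ^ d) * φ s) := by
        rw [ENNReal.ofReal_mul (by positivity)]
        ring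
end
end
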